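/- If a tetrahedron satisfies Rad(T) = diam(T), then it is regular, i.e. all six edges have the same length: dist a b = dist a c = dist a d = dist b c = dist b d = dist c d. -/

import Mathlib

open scoped ENNReal

/-- The intrinsic (geodesic) distance on a subset `T` of `ℝ³`: the infimum of the lengths of
continuous paths from `x` to `y` staying in `T`. -/
noncomputable def rho (T : Set (EuclideanSpace ℝ (Fin 3)))
    (x y : EuclideanSpace ℝ (Fin 3)) : ℝ≥0∞ :=
  ⨅ (γ : ℝ → EuclideanSpace ℝ (Fin 3)) (_ : Continuous γ) (_ : γ 0 = x) (_ : γ 1 = y)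
    (_ : ∀ t ∈ Set.Icc (0 : ℝ) 1, γ t ∈ T), eVariationOn γ (Set.Icc 0 1)

/-- Intrinsic diameter. -/
noncomputable def intrinsicDiam (T : Set (EuclideanSpace ℝ (Fin 3))) : ℝ≥0∞ :=
  ⨆ x ∈ T, ⨆ y ∈ T, rho T x y

/-- Intrinsic radius. -/
noncomputable def intrinsicRad (T : Set (EuclideanSpace ℝ (Fin 3))) : ℝ≥0∞ :=
  ⨅ x ∈ T, ⨆ y ∈ T, rho T x y

/-- Extrinsic radius. -/
noncomputable def extrinsicRad (T : Set (EuclideanSpace ℝ (Fin 3))) : ℝ≥0∞ :=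
  ⨅ x ∈ T, ⨆ y ∈ T, edist x y

open Set AffineMap

lemma rho_le_eVariationOn {T : Set (EuclideanSpace ℝ (Fin 3))} {x y : EuclideanSpace ℝ (Fin 3)}
    {f : ℝ → EuclideanSpace ℝ (Fin 3)} (hf : Continuous f) (h0 : f 0 = x) (h1 : f 1 = y)
    (hT : ∀ t ∈ Icc (0 : ℝ) 1, f t ∈ T) : rho T x y ≤ eVariationOn f (Icc 0 1) := by
  unfold rho
  exact iInf_le_of_le f <| iInf_le_of_le hf <| iInf_le_of_le h0 <| iInf_le_of_le h1 <|
    iInf_le_of_le hT le_rfl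

lemma rho_triangle (T : Set (EuclideanSpace ℝ (Fin 3))) (x y z : EuclideanSpace ℝ (Fin 3)) :
    rho T x z ≤ rho T x y + rho T y z := by
  conv_rhs => simp only [rho, ENNReal.iInf_add, ENNReal.add_iInf]
  refine le_iInf fun g => le_iInf fun hg => le_iInf fun hg0 => le_iInf fun hg1 => le_iInf fun hgT =>
    le_iInf fun f => le_iInf fun hf => le_iInf fun hf0 => le_iInf fun hf1 => le_iInf fun hfT => ?_
  set h : ℝ → EuclideanSpace ℝ (Fin 3) :=
    fun t => if t ≤ 1 / 2 then f (2 * t) else g (2 * t - 1) with hh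
  have hl : EqOn h (f ∘ fun t => 2 * t) (Icc 0 (1 / 2)) := fun t ht => if_pos ht.2
  have hr : EqOn h (g ∘ fun t => 2 * t - 1) (Icc (1 / 2) 1) := by
    intro t ht
    rcases ht.1.eq_or_lt with rfl | h'
    · norm_num [hh, hf1, hg0]
    · exact if_neg h'.not_ge
  have hcont : Continuous h := by
    refine Continuous.if_le (by fun_prop) (by fun_prop) continuous_id continuous_const ?_
    rintro t rfl
    norm_num [hf1, hg0]
  have hT : ∀ t ∈ Icc (0 : ℝ) 1, h t ∈ T := by
    intro t ht
    rcases le_total t (1 / 2) with h' | h'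
    · rw [hl ⟨ht.1, h'⟩]
      exact hfT _ ⟨by linarith [ht.1], by linarith⟩
    · rw [hr ⟨h', ht.2⟩]
      exact hgT _ ⟨by linarith, by linarith [ht.2]⟩
  have h0 : h 0 = x := by rw [hl (by norm_num)]; simpa using hf0
  have h1 : h 1 = z := by rw [hr (by norm_num)]; norm_num [hg1]
  have hvar : eVariationOn h (Icc 0 1) ≤ eVariationOn f (Icc 0 1) + eVariationOn g (Icc 0 1) := by
    have hsplit := eVariationOn.Icc_add_Icc h (s := univ) (a := (0 : ℝ)) (b := 1 / 2) (c := 1)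
      (by norm_num) (by norm_num) (mem_univ _)
    simp only [univ_inter] at hsplit
    rw [← hsplit, eVariationOn.congr hl, eVariationOn.congr hr]
    refine add_le_add (eVariationOn.comp_le_of_monotoneOn _ _ ?_ ?_)
      (eVariationOn.comp_le_of_monotoneOn _ _ ?_ ?_)
    · intro s _ t _ hst
      dsimp only
      linarith
    · intro t ht
      exact ⟨by linarith [ht.1], by linarith [ht.2]⟩
    · intro s _ t _ hst
      dsimp only
      linarith
    · intro t ht
      exact ⟨by linarith [ht.1], by linarith [ht.2]⟩
  exact (rho_le_eVariationOn hcont h0 h1 hT).trans hvar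

lemma rho_le_edist_of_segment_subset {T : Set (EuclideanSpace ℝ (Fin 3))}
    {x y : EuclideanSpace ℝ (Fin 3)} (h : segment ℝ x y ⊆ T) : rho T x y ≤ edist x y := by
  have hvar : eVariationOn (lineMap x y : ℝ →ᵃ[ℝ] EuclideanSpace ℝ (Fin 3)) (Icc 0 1)
      ≤ edist x y := by
    have h1 := LipschitzOnWith.comp_eVariationOn_le (g := id) (s := Icc (0 : ℝ) 1)
      ((lipschitzWith_lineMap (𝕜 := ℝ) x y).lipschitzOnWith (s := univ)) (mapsTo_univ _ _)
    calc _ ≤ _ := h1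
      _ ≤ (nndist x y : ℝ≥0∞) * 1 := by
        gcongr
        simp
      _ = edist x y := by rw [mul_one, edist_nndist]
  refine (rho_le_eVariationOn lineMap_continuous (lineMap_apply_zero x y)
    (lineMap_apply_one x y) ?_).trans hvar
  intro t ht
  exact h (segment_eq_image_lineMap ℝ x y ▸ mem_image_of_mem _ ht)

lemma rho_le_edist_of_convex {T F : Set (EuclideanSpace ℝ (Fin 3))} (hF : Convex ℝ F)
    (hFT : F ⊆ T) {x y : EuclideanSpace ℝ (Fin 3)} (hx : x ∈ F) (hy : y ∈ F) :
    rho T x y ≤ edist x y :=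
  rho_le_edist_of_segment_subset ((hF.segment_subset hx hy).trans hFT)

/-- On a compact convex piece of `T`, a pointwise strict bound on the intrinsic distance from `x`
is uniform. -/
lemma exists_forall_rho_le_lt {T F : Set (EuclideanSpace ℝ (Fin 3))} (hF : Convex ℝ F)
    (hFc : IsCompact F) (hFT : F ⊆ T) {x : EuclideanSpace ℝ (Fin 3)} {D : ℝ≥0∞} (hD : 0 < D)
    (h : ∀ y ∈ F, rho T x y < D) : ∃ r < D, ∀ y ∈ F, rho T x y ≤ r := by
  refine hFc.induction_on (p := fun S => ∃ r < D, ∀ y ∈ S, rho T x y ≤ r) ⟨0, hD, by simp⟩ ?_ ?_ ?_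
  · rintro s t hst ⟨r, hr, H⟩
    exact ⟨r, hr, fun y hy => H y (hst hy)⟩
  · rintro s t ⟨r, hr, H⟩ ⟨r', hr', H'⟩
    refine ⟨max r r', max_lt hr hr', ?_⟩
    rintro y (hy | hy)
    · exact (H y hy).trans (le_max_left _ _)
    · exact (H' y hy).trans (le_max_right _ _)
  · intro y hy
    obtain ⟨r, hyr, hrD⟩ := exists_between (h y hy)
    have hpos : 0 < r - rho T x y := tsub_pos_of_lt hyr
    refine ⟨F ∩ Metric.eball y (r - rho T x y),
      inter_mem_nhdsWithin _ (Metric.eball_mem_nhds y hpos), r, hrD, ?_⟩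
    rintro z ⟨hz, hzy⟩
    calc rho T x z ≤ rho T x y + rho T y z := rho_triangle T x y z
      _ ≤ rho T x y + (r - rho T x y) := by
        gcongr
        refine (rho_le_edist_of_convex hF hFT hy hz).trans ?_
        rw [edist_comm]
        exact (Metric.mem_eball.1 hzy).le
      _ = r := add_tsub_cancel_of_le hyr.le

lemma exists_weights_of_mem_convexHull_triple {V : Type*} [AddCommGroup V] [Module ℝ V]
    {a b c y : V} (hy : y ∈ convexHull ℝ ({a, b, c} : Set V)) :
    ∃ α β γ : ℝ, 0 ≤ α ∧ 0 ≤ β ∧ 0 ≤ γ ∧ α + β + γ = 1 ∧ α • a + β • b + γ • c = y := by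
  rw [convexHull_insert (by simp), convexHull_pair, mem_convexJoin] at hy
  obtain ⟨a', ha', z, ⟨β, γ, hβ, hγ, hs, rfl⟩, s, t, hs0, ht0, hst, rfl⟩ := hy
  obtain rfl : a' = a := by simpa using ha'
  refine ⟨s, t * β, t * γ, hs0, by positivity, by positivity, ?_, ?_⟩
  · rw [add_assoc, ← mul_add, hs, mul_one, hst]
  · module

section StrictConvex

variable {V : Type*} [NormedAddCommGroup V] [InnerProductSpace ℝ V]

lemma dist_midpoint_midpoint_left (a b c : V) :
    dist (midpoint ℝ a b) (midpoint ℝ a c) = dist b c / 2 := by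
  rw [dist_eq_norm, dist_eq_norm, midpoint_eq_smul_add, midpoint_eq_smul_add,
    show (⅟2 : ℝ) • (a + b) - (⅟2 : ℝ) • (a + c) = (2⁻¹ : ℝ) • (b - c) by
      simp only [invOf_eq_inv]; module, norm_smul]
  norm_num
  ring

lemma dist_midpoint_lt_of_mem_convexHull {a b c y : V} (hab : a ≠ b)
    (hac : dist a c ≤ dist a b) (hbc : dist b c ≤ dist a b)
    (hy : y ∈ convexHull ℝ ({a, b, c} : Set V)) : dist (midpoint ℝ a b) y < dist a b := by
  have hpos : 0 < dist a b := dist_pos.2 hab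
  suffices h : convexHull ℝ ({a, b, c} : Set V) ⊆ Metric.ball (midpoint ℝ a b) (dist a b) by
    rw [dist_comm]
    exact h hy
  refine convexHull_min ?_ (convex_ball _ _)
  have hc : midpoint ℝ a b ∈ Metric.ball c (dist a b) := by
    have := combo_mem_ball_of_ne (a := (2⁻¹ : ℝ)) (b := 2⁻¹) (Metric.mem_closedBall.2 hac)
      (Metric.mem_closedBall.2 hbc) hab (by norm_num) (by norm_num) (by norm_num)
    rwa [midpoint_eq_smul_add, smul_add, invOf_eq_inv]
  rintro z (rfl | rfl | rfl)
  · rw [Metric.mem_ball, dist_left_midpoint]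
    norm_num
    linarith
  · rw [Metric.mem_ball, dist_right_midpoint]
    norm_num
    linarith
  · rw [Metric.mem_ball']
    exact hc

/-- The point `y` lies in the triangle spanned by `a`, `c` and the midpoint of `c` and `d`, off the
side `ac`. -/
lemma dist_midpoint_add_dist_lt {a b c d : V} {D α γ δ : ℝ} (hbc : dist b c ≤ D)
    (had : dist a d ≤ D) (hac : dist a c ≤ D) (hα : 0 ≤ α) (hδ : 0 < δ) (hδγ : δ ≤ γ)
    (hsum : α + γ + δ = 1) (hne : α • a + γ • c + δ • d ≠ midpoint ℝ c d) :
    dist (midpoint ℝ a b) (midpoint ℝ a c) +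
      dist (midpoint ℝ a c) (α • a + γ • c + δ • d) < D := by
  rw [dist_midpoint_midpoint_left]
  suffices h : α • a + γ • c + δ • d ∈ Metric.ball (midpoint ℝ a c) (D / 2) by
    rw [Metric.mem_ball'] at h
    linarith
  have hlt : 0 < 1 - 2 * δ := by
    by_contra! hcon
    obtain rfl : α = 0 := by linarith
    obtain rfl : δ = 2⁻¹ := by linarith
    obtain rfl : γ = 2⁻¹ := by linarith
    apply hne
    rw [midpoint_eq_smul_add, invOf_eq_inv]
    module
  set z : V := (α / (1 - 2 * δ)) • a + ((γ - δ) / (1 - 2 * δ)) • c with hz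
  have hy : α • a + γ • c + δ • d = (1 - 2 * δ) • z + (2 * δ) • midpoint ℝ c d := by
    rw [hz, smul_add, smul_smul, smul_smul, mul_div_cancel₀ _ hlt.ne', mul_div_cancel₀ _ hlt.ne',
      midpoint_eq_smul_add, invOf_eq_inv]
    module
  rw [hy] at hne ⊢
  refine combo_mem_ball_of_ne ?_ ?_ ?_ hlt (by linarith) (by ring)
  · refine (convex_closedBall _ _) ?_ ?_ (div_nonneg hα hlt.le)
      (div_nonneg (sub_nonneg.2 hδγ) hlt.le) ?_
    · rw [Metric.mem_closedBall, dist_left_midpoint]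
      norm_num
      linarith
    · rw [Metric.mem_closedBall, dist_right_midpoint]
      norm_num
      linarith
    · rw [← add_div, div_eq_one_iff_eq hlt.ne']
      linarith
  · rw [Metric.mem_closedBall, midpoint_comm a c, dist_midpoint_midpoint_left, dist_comm]
    linarith
  · intro h
    rw [h] at hne
    exact hne (by module)

end StrictConvex

section Surface

variable {T : Set (EuclideanSpace ℝ (Fin 3))} {a b c d : EuclideanSpace ℝ (Fin 3)}

/-- Going from the midpoint of `ab` to a point of the face `acd` through the midpoint of `ac`. -/
lemma rho_midpoint_lt (habc : convexHull ℝ {a, b, c} ⊆ T) (hacd : convexHull ℝ {a, c, d} ⊆ T)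
    {y : EuclideanSpace ℝ (Fin 3)} (hy : y ∈ convexHull ℝ {a, c, d}) {D : ℝ}
    (h : dist (midpoint ℝ a b) (midpoint ℝ a c) + dist (midpoint ℝ a c) y < D) :
    rho T (midpoint ℝ a b) y < ENNReal.ofReal D := by
  have hmem {s : Set (EuclideanSpace ℝ (Fin 3))} {u v : EuclideanSpace ℝ (Fin 3)}
      (hu : u ∈ s) (hv : v ∈ s) : midpoint ℝ u v ∈ convexHull ℝ s :=
    (convex_convexHull ℝ s).midpoint_mem (subset_convexHull ℝ s hu) (subset_convexHull ℝ s hv)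
  calc rho T (midpoint ℝ a b) y
      ≤ rho T (midpoint ℝ a b) (midpoint ℝ a c) + rho T (midpoint ℝ a c) y := rho_triangle ..
    _ ≤ edist (midpoint ℝ a b) (midpoint ℝ a c) + edist (midpoint ℝ a c) y :=
      add_le_add
        (rho_le_edist_of_convex (convex_convexHull ℝ _) habc (hmem (by simp) (by simp))
          (hmem (by simp) (by simp)))
        (rho_le_edist_of_convex (convex_convexHull ℝ _) hacd (hmem (by simp) (by simp)) hy)
    _ < ENNReal.ofReal D := by
      rw [edist_dist, edist_dist, ← ENNReal.ofReal_add dist_nonneg dist_nonneg]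
      exact (ENNReal.ofReal_lt_ofReal_iff (lt_of_le_of_lt (by positivity) h)).2 h

lemma rho_midpoint_lt_of_mem_adjacent (habc : convexHull ℝ {a, b, c} ⊆ T) (hab : a ≠ b)
    (hac : dist a c ≤ dist a b) (hbc : dist b c ≤ dist a b)
    {y : EuclideanSpace ℝ (Fin 3)} (hy : y ∈ convexHull ℝ {a, b, c}) :
    rho T (midpoint ℝ a b) y < ENNReal.ofReal (dist a b) := by
  refine (rho_le_edist_of_convex (convex_convexHull ℝ _) habc
    ((convex_convexHull ℝ _).midpoint_mem (subset_convexHull ℝ _ (by simp))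
      (subset_convexHull ℝ _ (by simp))) hy).trans_lt ?_
  rw [edist_dist]
  exact (ENNReal.ofReal_lt_ofReal_iff (dist_pos.2 hab)).2
    (dist_midpoint_lt_of_mem_convexHull hab hac hbc hy)

lemma rho_midpoint_lt_of_weights (habc : convexHull ℝ {a, b, c} ⊆ T)
    (hacd : convexHull ℝ {a, c, d} ⊆ T) (hab : a ≠ b)
    (hac : dist a c ≤ dist a b) (hbc : dist b c ≤ dist a b) (had : dist a d ≤ dist a b)
    {α γ δ : ℝ} (hα : 0 ≤ α) (hδ : 0 ≤ δ) (hδγ : δ ≤ γ) (hsum : α + γ + δ = 1)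
    (hne : α • a + γ • c + δ • d ≠ midpoint ℝ c d) :
    rho T (midpoint ℝ a b) (α • a + γ • c + δ • d) < ENNReal.ofReal (dist a b) := by
  rcases hδ.eq_or_lt with rfl | hδ
  · refine rho_midpoint_lt_of_mem_adjacent habc hab hac hbc ?_
    rw [zero_smul, add_zero]
    exact convex_convexHull ℝ _ (subset_convexHull ℝ _ (by simp))
      (subset_convexHull ℝ _ (by simp)) hα hδγ (by linarith)
  · refine rho_midpoint_lt habc hacd ?_
      (dist_midpoint_add_dist_lt hbc had hac hα hδ hδγ hsum hne)
    refine mem_convexHull_of_exists_fintype ![α, γ, δ] ![a, c, d] ?_ ?_ ?_ ?_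
    · intro i
      fin_cases i <;> simp <;> linarith
    · simp [Fin.sum_univ_three, hsum]
    · intro i
      fin_cases i <;> simp
    · simp [Fin.sum_univ_three]

lemma rho_midpoint_lt_of_mem_opposite (habc : convexHull ℝ {a, b, c} ⊆ T)
    (habd : convexHull ℝ {a, b, d} ⊆ T) (hacd : convexHull ℝ {a, c, d} ⊆ T) (hab : a ≠ b)
    (hac : dist a c ≤ dist a b) (had : dist a d ≤ dist a b)
    (hbc : dist b c ≤ dist a b) (hbd : dist b d ≤ dist a b)
    (hlt : dist a c < dist a b ∨ dist a d < dist a b ∨ dist b c < dist a b ∨ dist b d < dist a b)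
    {y : EuclideanSpace ℝ (Fin 3)} (hy : y ∈ convexHull ℝ {a, c, d}) :
    rho T (midpoint ℝ a b) y < ENNReal.ofReal (dist a b) := by
  have hadc : convexHull ℝ {a, d, c} ⊆ T := by rwa [pair_comm d c]
  have hy' : y ∈ convexHull ℝ {a, d, c} := by rwa [pair_comm d c]
  by_cases hm : y = midpoint ℝ c d
  · have hc : dist (midpoint ℝ a c) y = dist a d / 2 := by
      rw [hm, midpoint_comm, dist_midpoint_midpoint_left]
    have hd : dist (midpoint ℝ a d) y = dist a c / 2 := by
      rw [hm, midpoint_comm, midpoint_comm c d, dist_midpoint_midpoint_left]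
    by_cases h : dist b c + dist a d < 2 * dist a b
    · refine rho_midpoint_lt habc hacd hy ?_
      rw [dist_midpoint_midpoint_left, hc]
      linarith
    · refine rho_midpoint_lt habd hadc hy' ?_
      rw [dist_midpoint_midpoint_left, hd]
      rcases hlt with h' | h' | h' | h' <;> linarith
  · obtain ⟨α, γ, δ, hα, hγ, hδ, hsum, rfl⟩ := exists_weights_of_mem_convexHull_triple hy
    rcases le_total δ γ with h | h
    · exact rho_midpoint_lt_of_weights habc hacd hab hac hbc had hα hδ h hsum hm
    · rw [add_right_comm] at hm ⊢
      rw [midpoint_comm] at hm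
      exact rho_midpoint_lt_of_weights habd hadc hab had hbd hac hα hγ h (by linarith) hm

/-- If `ab` is a longest edge and one of the four edges adjacent to it is shorter, then the midpoint
of `ab` witnesses that the intrinsic radius is smaller than `ab`. -/
lemma intrinsicRad_lt_edist (habc : convexHull ℝ {a, b, c} ⊆ T)
    (habd : convexHull ℝ {a, b, d} ⊆ T) (hacd : convexHull ℝ {a, c, d} ⊆ T)
    (hbcd : convexHull ℝ {b, c, d} ⊆ T)
    (hT : ∀ y ∈ T, y ∈ convexHull ℝ {a, b, c} ∨ y ∈ convexHull ℝ {a, b, d} ∨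
      y ∈ convexHull ℝ {a, c, d} ∨ y ∈ convexHull ℝ {b, c, d}) (hab : a ≠ b)
    (hac : dist a c ≤ dist a b) (had : dist a d ≤ dist a b)
    (hbc : dist b c ≤ dist a b) (hbd : dist b d ≤ dist a b)
    (hlt : dist a c < dist a b ∨ dist a d < dist a b ∨ dist b c < dist a b ∨
      dist b d < dist a b) :
    intrinsicRad T < edist a b := by
  rw [edist_dist]
  have hD : 0 < ENNReal.ofReal (dist a b) := ENNReal.ofReal_pos.2 (dist_pos.2 hab)
  have hface {u v w : EuclideanSpace ℝ (Fin 3)} (hF : convexHull ℝ {u, v, w} ⊆ T)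
      (h : ∀ y ∈ convexHull ℝ {u, v, w},
        rho T (midpoint ℝ a b) y < ENNReal.ofReal (dist a b)) :=
    exists_forall_rho_le_lt (convex_convexHull ℝ _)
      ((Set.toFinite _).isCompact_convexHull (𝕜 := ℝ)) hF hD h
  obtain ⟨r₁, hr₁, h₁⟩ := hface habc fun y hy =>
    rho_midpoint_lt_of_mem_adjacent habc hab hac hbc hy
  obtain ⟨r₂, hr₂, h₂⟩ := hface habd fun y hy =>
    rho_midpoint_lt_of_mem_adjacent habd hab had hbd hy
  obtain ⟨r₃, hr₃, h₃⟩ := hface hacd fun y hy =>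
    rho_midpoint_lt_of_mem_opposite habc habd hacd hab hac had hbc hbd hlt hy
  obtain ⟨r₄, hr₄, h₄⟩ := hface hbcd fun y hy => by
    rw [midpoint_comm, dist_comm a b]
    rw [dist_comm a b] at hac had hbc hbd hlt
    exact rho_midpoint_lt_of_mem_opposite (by rwa [insert_comm]) (by rwa [insert_comm]) hbcd
      hab.symm hbc hbd hac had (by tauto) hy
  have hx : midpoint ℝ a b ∈ T := habc <| (convex_convexHull ℝ _).midpoint_mem
    (subset_convexHull ℝ _ (by simp)) (subset_convexHull ℝ _ (by simp))
  refine (iInf₂_le _ hx).trans_lt (lt_of_le_of_lt (b := max (max r₁ r₂) (max r₃ r₄)) ?_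
    (max_lt (max_lt hr₁ hr₂) (max_lt hr₃ hr₄)))
  refine iSup₂_le fun y hy => ?_
  rcases hT y hy with h | h | h | h
  · exact (h₁ y h).trans (by simp)
  · exact (h₂ y h).trans (by simp)
  · exact (h₃ y h).trans (by simp)
  · exact (h₄ y h).trans (by simp)

end Surface

/-- The boundary of a full-dimensional simplex is the union of its facets. -/
lemma AffineBasis.mem_frontier_convexHull_iff {ι V : Type*} [Fintype ι]
    [NormedAddCommGroup V] [NormedSpace ℝ V] (v : AffineBasis ι ℝ V) (y : V) :
    y ∈ frontier (convexHull ℝ (range v)) ↔ ∃ n, y ∈ convexHull ℝ (v '' {n}ᶜ) := by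
  classical
  rw [((Set.finite_range v).isClosed_convexHull (𝕜 := ℝ)).frontier_eq, v.interior_convexHull]
  constructor
  · rintro ⟨hy, hy'⟩
    rw [v.convexHull_eq_nonneg_coord] at hy
    simp only [mem_ofPred_eq, not_forall, not_lt] at hy hy'
    obtain ⟨n, hn⟩ := hy'
    have hn0 : v.coord n y = 0 := le_antisymm hn (hy n)
    refine ⟨n, ?_⟩
    have h1 := v.sum_coord_apply_eq_one y
    have h2 := v.linear_combination_coord_eq_self y
    rw [← Finset.add_sum_erase _ _ (Finset.mem_univ n), hn0, zero_add] at h1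
    rw [← Finset.add_sum_erase _ _ (Finset.mem_univ n), hn0, zero_smul, zero_add] at h2
    rw [← h2]
    refine (convex_convexHull ℝ _).sum_mem (fun i _ => hy i) h1 fun i hi => ?_
    exact subset_convexHull ℝ _ (mem_image_of_mem _ (Finset.ne_of_mem_erase hi))
  · rintro ⟨n, hn⟩
    refine ⟨convexHull_mono (image_subset_range _ _) hn, fun h => (h n).ne' ?_⟩
    have hsub : convexHull ℝ (v '' {n}ᶜ) ⊆ v.coord n ⁻¹' {0} := by
      refine convexHull_min ?_ ((convex_singleton 0).affine_preimage _)
      rintro _ ⟨i, hi, rfl⟩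
      exact v.coord_apply_ne (Ne.symm hi)
    exact hsub hn

lemma dist_eq_of_isMax {v : Fin 4 → EuclideanSpace ℝ (Fin 3)} (hv : AffineIndependent ℝ v)
    {T : Set (EuclideanSpace ℝ (Fin 3))} (hT : T = frontier (convexHull ℝ (range v)))
    (hrad : Metric.ediam T ≤ intrinsicRad T) {i j k l : Fin 4} (hij : i ≠ j) (hik : i ≠ k)
    (hil : i ≠ l) (hjk : j ≠ k) (hjl : j ≠ l) (hkl : k ≠ l)
    (hmax : ∀ m n, dist (v m) (v n) ≤ dist (v i) (v j)) :
    dist (v i) (v k) = dist (v i) (v j) ∧ dist (v i) (v l) = dist (v i) (v j) ∧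
      dist (v j) (v k) = dist (v i) (v j) ∧ dist (v j) (v l) = dist (v i) (v j) := by
  let B : AffineBasis (Fin 4) ℝ (EuclideanSpace ℝ (Fin 3)) :=
    ⟨v, hv, hv.affineSpan_eq_top_iff_card_eq_finrank_add_one.2 (by simp)⟩
  have hB : ∀ y, y ∈ T ↔ ∃ n, y ∈ convexHull ℝ (v '' {n}ᶜ) := by
    rw [hT]
    exact B.mem_frontier_convexHull_iff
  have hcompl {p q r s : Fin 4} (h₁ : p ≠ q) (h₂ : p ≠ r) (h₃ : p ≠ s) (h₄ : q ≠ r) (h₅ : q ≠ s)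
      (h₆ : r ≠ s) : v '' {s}ᶜ = {v p, v q, v r} := by
    have : ({s}ᶜ : Set (Fin 4)) = {p, q, r} := by
      ext n
      simp only [mem_compl_iff, mem_singleton_iff, mem_insert_iff]
      omega
    rw [this, image_insert_eq, image_pair]
  have e₁ := hcompl hij hik hil hjk hjl hkl
  have e₂ := hcompl hij hil hik hjl hjk hkl.symm
  have e₃ := hcompl hik hil hij hkl hjk.symm hjl.symm
  have e₄ := hcompl hjk hjl hij.symm hkl hik.symm hil.symm
  have f₁ : convexHull ℝ {v i, v j, v k} ⊆ T := fun y hy => (hB y).2 ⟨l, e₁ ▸ hy⟩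
  by_contra hcon
  have hlt := intrinsicRad_lt_edist (T := T) (a := v i) (b := v j) (c := v k) (d := v l) f₁
    (fun y hy => (hB y).2 ⟨k, e₂ ▸ hy⟩) (fun y hy => (hB y).2 ⟨j, e₃ ▸ hy⟩)
    (fun y hy => (hB y).2 ⟨i, e₄ ▸ hy⟩) (fun y hy => by
      obtain ⟨n, hn⟩ := (hB y).1 hy
      obtain rfl | rfl | rfl | rfl : n = l ∨ n = k ∨ n = j ∨ n = i := by omega
      · exact Or.inl (e₁ ▸ hn)
      · exact Or.inr (Or.inl (e₂ ▸ hn))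
      · exact Or.inr (Or.inr (Or.inl (e₃ ▸ hn)))
      · exact Or.inr (Or.inr (Or.inr (e₄ ▸ hn))))
    (hv.injective.ne hij) (hmax _ _) (hmax _ _) (hmax _ _) (hmax _ _) (by
      by_contra! h
      exact hcon ⟨(hmax _ _).antisymm h.1, (hmax _ _).antisymm h.2.1,
        (hmax _ _).antisymm h.2.2.1, (hmax _ _).antisymm h.2.2.2⟩)
  have hdiam : edist (v i) (v j) ≤ Metric.ediam T :=
    Metric.edist_le_ediam_of_mem (f₁ (subset_convexHull ℝ _ (by simp)))
      (f₁ (subset_convexHull ℝ _ (by simp)))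
  exact (hlt.trans_le (hdiam.trans hrad)).false

theorem stmt2 (a b c d : EuclideanSpace ℝ (Fin 3))
    (hind : AffineIndependent ℝ ![a, b, c, d])
    (T : Set (EuclideanSpace ℝ (Fin 3)))
    (hT : T = frontier (convexHull ℝ ({a, b, c, d} : Set (EuclideanSpace ℝ (Fin 3)))))
    (heq : intrinsicRad T = EMetric.diam T) :
    dist a b = dist a c ∧ dist a c = dist a d ∧ dist a d = dist b c ∧
      dist b c = dist b d ∧ dist b d = dist c d := by
  set v := ![a, b, c, d] with hv
  have hrange : range v = {a, b, c, d} := by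
    simp only [hv, Matrix.range_cons, Matrix.range_empty, union_empty, singleton_union]
  rw [← hrange] at hT
  obtain ⟨⟨i, j⟩, hmax⟩ := Finite.exists_max fun p : Fin 4 × Fin 4 => dist (v p.1) (v p.2)
  replace hmax : ∀ m n, dist (v m) (v n) ≤ dist (v i) (v j) := fun m n => hmax (m, n)
  have hij : i ≠ j := by
    rintro rfl
    have h := hmax 0 1
    rw [dist_self, dist_le_zero] at h
    exact absurd (hind.injective h) (by decide)
  obtain ⟨k, l, hik, hil, hjk, hjl, hkl⟩ :
      ∃ k l : Fin 4, i ≠ k ∧ i ≠ l ∧ j ≠ k ∧ j ≠ l ∧ k ≠ l := by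
    clear hmax
    revert i j
    decide
  obtain ⟨h₁, h₂, h₃, h₄⟩ := dist_eq_of_isMax hind hT heq.ge hij hik hil hjk hjl hkl hmax
  obtain ⟨-, -, -, h₅⟩ := dist_eq_of_isMax hind hT heq.ge hjk hij.symm hjl hik.symm hkl hil
    (by rwa [h₃])
  have hall : ∀ m n, m ≠ n → dist (v m) (v n) = dist (v i) (v j) := by
    intro m n hmn
    have hm : m = i ∨ m = j ∨ m = k ∨ m = l := by omega
    have hn : n = i ∨ n = j ∨ n = k ∨ n = l := by omega
    rw [h₃] at h₅
    rcases hm with rfl | rfl | rfl | rfl <;> rcases hn with rfl | rfl | rfl | rfl <;>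
      first
      | exact absurd rfl hmn
      | rfl
      | assumption
      | (rw [dist_comm]; assumption)
      | exact dist_comm _ _
  have h01 : dist a b = _ := hall 0 1 (by decide)
  have h02 : dist a c = _ := hall 0 2 (by decide)
  have h03 : dist a d = _ := hall 0 3 (by decide)
  have h12 : dist b c = _ := hall 1 2 (by decide)
  have h13 : dist b d = _ := hall 1 3 (by decide)
  have h23 : dist c d = _ := hall 2 3 (by decide)
  exact ⟨h01.trans h02.symm, h02.trans h03.symm, h03.trans h12.symm, h12.trans h13.symm,
    h13.trans h23.symm⟩
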